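/- arXiv:2204.14086 — 2 statements merged into one kernel-verified Lean document; each statement's English description precedes it below -/
import Mathlib

section
/- There exists an absolute constant C₀ with the following property. Let G be a connected unweighted graph on n vertices and let D ≥ 1 and ξ ≥ 1 be reals. Suppose that for every nonempty subset S ⊆ V(G), the induced subgraph G[S] admits a collection 𝒞 of pairwise disjoint nonempty clusters together with, for each cluster C ∈ 𝒞, a connected subgraph (tree) T_C of G[S] with V(T_C) ⊇ C and diameter at most D, such that: any two distinct clusters are at distance at least 3 in G[S], the clusters together contain at least |S|/2 vertices, and Σ_{C∈𝒞} |V(T_C)| ≤ ξ·|S|. Then G has a spanner H with at most C₀·ξ·n edges and stretch at most C₀·D. -/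
open SimpleGraph

/-- Weighted shortest-path distance in a graph `G` with edge weights `w`
(`⊤` if `u` and `v` are not connected). For `w = fun _ => 1` this is the hop distance. -/
noncomputable def wdist {V : Type*} (G : SimpleGraph V) (w : Sym2 V → NNReal) (u v : V) :
    ENNReal :=
  ⨅ p : G.Walk u v, ((p.edges.map w).sum : ENNReal)

/-- `H` is an `α`-spanner of the weighted graph `(G, w)`: `H` is a subgraph of `G` and
all pairwise distances are stretched by a factor of at most `α`. -/
def IsSpanner {V : Type*} (G H : SimpleGraph V) (w : Sym2 V → NNReal) (α : ℝ) : Prop :=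
  H ≤ G ∧ ∀ u v : V, wdist H w u v ≤ ENNReal.ofReal α * wdist G w u v

/-- The subgraph of `G` induced by the vertex set `S` (kept on the same vertex type):
only the edges of `G` with both endpoints in `S` are kept. -/
def within {V : Type*} (G : SimpleGraph V) (S : Set V) : SimpleGraph V :=
  SimpleGraph.fromRel (fun u v => G.Adj u v ∧ u ∈ S ∧ v ∈ S)

/-- A finite forest has at most as many edges as vertices. -/
lemma SimpleGraph.IsAcyclic.ncard_edgeSet_le {V : Type*} [Finite V] {T : SimpleGraph V}
    (hT : T.IsAcyclic) : T.edgeSet.ncard ≤ Nat.card V := by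
  classical
  cases isEmpty_or_nonempty V with
  | inl h => simp [Set.eq_empty_of_isEmpty]
  | inr h =>
    have := Fintype.ofFinite V
    obtain ⟨F, hTF, -, hF⟩ :=
      (connected_top (V := V)).exists_isTree_le_of_le_of_isAcyclic le_top hT
    have hcard := hF.card_edgeFinset
    have hle : T.edgeSet.ncard ≤ F.edgeSet.ncard :=
      Set.ncard_le_ncard (edgeSet_mono hTF)
    rw [Set.ncard_eq_toFinset_card' F.edgeSet] at hle
    rw [Nat.card_eq_fintype_card]
    simp only [edgeFinset] at hcard
    omega

/-- A forest whose edges all lie in a finite set `A` has at most `A.ncard` edges. -/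
lemma SimpleGraph.IsAcyclic.ncard_edgeSet_le_ncard {V : Type*} {T : SimpleGraph V} {A : Set V}
    (hA : A.Finite) (hT : T.IsAcyclic) (hTA : ∀ u v, T.Adj u v → u ∈ A ∧ v ∈ A) :
    T.edgeSet.ncard ≤ A.ncard := by
  have := hA.to_subtype
  have hmap : T.edgeSet ⊆ Sym2.map (Subtype.val : A → V) '' (T.induce A).edgeSet := by
    intro e
    induction e using Sym2.ind with
    | _ u v =>
      intro h
      obtain ⟨hu, hv⟩ := hTA u v h
      exact ⟨s(⟨u, hu⟩, ⟨v, hv⟩), h, rfl⟩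
  calc T.edgeSet.ncard
      ≤ (Sym2.map (Subtype.val : A → V) '' (T.induce A).edgeSet).ncard :=
        Set.ncard_le_ncard hmap (Set.toFinite _)
    _ ≤ (T.induce A).edgeSet.ncard := Set.ncard_image_le (Set.toFinite _)
    _ ≤ Nat.card A := (hT.induce A).ncard_edgeSet_le
    _ = A.ncard := Nat.card_coe_set_eq A

lemma wdist_one_le_length {V : Type*} {G : SimpleGraph V} {u v : V} (p : G.Walk u v) :
    wdist G (fun _ => 1) u v ≤ p.length := by
  refine (iInf_le _ p).trans (le_of_eq ?_)
  simp

/-- To be a spanner of an unweighted graph, it suffices to stretch single edges by at most `α`. -/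
lemma isSpanner_of_adj {V : Type*} {G H : SimpleGraph V} {α : ℝ} (hα : 0 < α) (hHG : H ≤ G)
    (h : ∀ u v, G.Adj u v → ∃ p : H.Walk u v, (p.length : ℝ) ≤ α) :
    IsSpanner G H (fun _ => 1) α := by
  refine ⟨hHG, fun u v => ?_⟩
  have hwalk : ∀ {u v : V} (p : G.Walk u v), ∃ q : H.Walk u v, (q.length : ℝ) ≤ α * p.length := by
    intro u v p
    induction p with
    | nil => exact ⟨.nil, by simp⟩
    | cons hadj p ih =>
      obtain ⟨q, hq⟩ := ih
      obtain ⟨r, hr⟩ := h _ _ hadj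
      refine ⟨r.append q, ?_⟩
      rw [Walk.length_append, Walk.length_cons]
      push_cast
      linarith
  rw [wdist.eq_1 G, ENNReal.mul_iInf_of_ne (by simpa using hα) ENNReal.ofReal_ne_top]
  refine le_iInf fun p => ?_
  obtain ⟨q, hq⟩ := hwalk p
  refine (wdist_one_le_length q).trans ?_
  have hp : (((p.edges.map fun _ => (1 : NNReal)).sum : NNReal) : ENNReal)
      = ENNReal.ofReal p.length := by simp
  rw [hp, ← ENNReal.ofReal_mul hα.le, ← ENNReal.ofReal_natCast]
  exact ENNReal.ofReal_le_ofReal hq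

/-- Two vertices of `S` with a common neighbour in `S` are at distance less than `3` in `G[S]`. -/
lemma wdist_within_lt_three {V : Type*} {G : SimpleGraph V} {S : Set V} {u v w : V}
    (hu : u ∈ S) (hv : v ∈ S) (hw : w ∈ S) (huv : G.Adj u v) (hvw : G.Adj v w) :
    wdist (within G S) (fun _ => 1) u w < 3 := by
  have h₁ : (within G S).Adj u v := by simp [within, huv, huv.ne, hu, hv]
  have h₂ : (within G S).Adj v w := by simp [within, hvw, hvw.ne, hv, hw]
  refine (wdist_one_le_length (.cons h₁ (.cons h₂ .nil))).trans_lt ?_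
  simp only [Walk.length_cons, Walk.length_nil]
  norm_num

/-- if every induced subgraph `G[S]` of a connected `n`-vertex graph `G`
admits a `3`-separated weak-diameter clustering (clusters with trees of diameter at most
`D`, covering at least half of `S`, with total tree size at most `ξ·|S|`), then `G` has a
spanner with `O(ξ·n)` edges and stretch `O(D)`. -/
theorem spanner_of_weak_diameter_clustering :
    ∃ C₀ : ℝ, 0 < C₀ ∧
      ∀ (n : ℕ) (G : SimpleGraph (Fin n)), G.Connected →
        ∀ (D ξ : ℝ), 1 ≤ D → 1 ≤ ξ →
          (∀ S : Set (Fin n), S.Nonempty →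
            ∃ (m : ℕ) (cl tv : Fin m → Set (Fin n)) (tr : Fin m → SimpleGraph (Fin n)),
              (∀ i, (cl i).Nonempty) ∧
              (Pairwise fun i j => Disjoint (cl i) (cl j)) ∧
              (∀ i, cl i ⊆ tv i) ∧
              (∀ i, tv i ⊆ S) ∧
              (∀ i, tr i ≤ G) ∧
              (∀ i, ∀ u v : Fin n, (tr i).Adj u v → u ∈ tv i ∧ v ∈ tv i) ∧
              (∀ i, (tr i).IsAcyclic) ∧
              (∀ i, ∀ u ∈ tv i, ∀ v ∈ tv i, ∃ p : (tr i).Walk u v, (p.length : ℝ) ≤ D) ∧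
              (∀ i j, i ≠ j → ∀ u ∈ cl i, ∀ v ∈ cl j,
                (3 : ENNReal) ≤ wdist (within G S) (fun _ => 1) u v) ∧
              ((S.ncard : ℝ) / 2 ≤ ((⋃ i, cl i).ncard : ℝ)) ∧
              ((∑ i, ((tv i).ncard : ℝ)) ≤ ξ * S.ncard)) →
          ∃ H : SimpleGraph (Fin n),
            IsSpanner G H (fun _ => 1) (C₀ * D) ∧ (H.edgeSet.ncard : ℝ) ≤ C₀ * ξ * n := by
  refine ⟨4, by norm_num, fun n G _ D ξ hD hξ hclust => ?_⟩
  suffices key : ∀ (k : ℕ) (S : Set (Fin n)), S.ncard ≤ k → ∃ H ≤ G,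
      (H.edgeSet.ncard : ℝ) ≤ 4 * ξ * S.ncard ∧
      ∀ u ∈ S, ∀ v ∈ S, G.Adj u v → ∃ p : H.Walk u v, (p.length : ℝ) ≤ D + 1 by
    obtain ⟨H, hHG, hcard, hH⟩ := key _ Set.univ le_rfl
    refine ⟨H, isSpanner_of_adj (by linarith) hHG fun u v huv => ?_, by simpa using hcard⟩
    obtain ⟨p, hp⟩ := hH u trivial v trivial huv
    exact ⟨p, by linarith⟩
  intro k
  induction k with
  | zero =>
    intro S hS
    have hS : S = ∅ := (Set.ncard_eq_zero).1 (Nat.le_zero.1 hS)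
    exact ⟨⊥, bot_le, by simp [hS], by simp [hS]⟩
  | succ k ih =>
    intro S hSk
    obtain rfl | hne := S.eq_empty_or_nonempty
    · exact ⟨⊥, bot_le, by simp, by simp⟩
    obtain ⟨m, cl, tv, tr, -, -, hclt, htS, htG, htv, hac, hdiam, hsep, hcov, hsum⟩ :=
      hclust S hne
    have hclS : (⋃ i, cl i) ⊆ S := Set.iUnion_subset fun i => (hclt i).trans (htS i)
    have hSpos : (0 : ℝ) < S.ncard := by exact_mod_cast (Set.ncard_pos).2 hne
    have hdiff : ((S \ ⋃ i, cl i).ncard : ℝ) + (⋃ i, cl i).ncard = S.ncard := by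
      exact_mod_cast Set.ncard_sdiff_add_ncard_of_subset hclS
    obtain ⟨H', hH'G, hH'card, hH'⟩ := ih (S \ ⋃ i, cl i) (by
      have : ((S \ ⋃ i, cl i).ncard : ℝ) < S.ncard := by linarith
      have : (S \ ⋃ i, cl i).ncard < S.ncard := by exact_mod_cast this
      omega)
    have hnbr : ∀ v, ∃ w, (∃ u ∈ ⋃ i, cl i, G.Adj v u) → w ∈ (⋃ i, cl i) ∧ G.Adj v w := by
      intro v
      by_cases h : ∃ u ∈ ⋃ i, cl i, G.Adj v u
      · exact h.imp fun w hw _ => hw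
      · exact ⟨v, fun h' => absurd h' h⟩
    choose g hg using hnbr
    set F : SimpleGraph (Fin n) := G ⊓ fromEdgeSet ((fun v => s(v, g v)) '' S) with hF
    have hFcard : F.edgeSet.ncard ≤ S.ncard := by
      refine (Set.ncard_le_ncard ?_).trans (Set.ncard_image_le (f := fun v => s(v, g v)) (s := S))
      refine (edgeSet_mono inf_le_right).trans ?_
      rw [edgeSet_fromEdgeSet]
      exact Set.sdiff_subset
    have htrcard : (((⨆ i, tr i).edgeSet.ncard : ℕ) : ℝ) ≤ ξ * S.ncard := by
      refine le_trans ?_ hsum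
      rw [edgeSet_iSup]
      exact_mod_cast (Set.ncard_iUnion_le_of_fintype _).trans (Finset.sum_le_sum fun i _ =>
        (hac i).ncard_edgeSet_le_ncard (Set.toFinite _) (htv i))
    have hcluster : ∀ u ∈ ⋃ i, cl i, ∀ v ∈ S, G.Adj v u →
        ∃ p : (H' ⊔ (⨆ i, tr i) ⊔ F).Walk u v, (p.length : ℝ) ≤ D + 1 := by
      intro u hu v hv hvu
      obtain ⟨hgv, hadj⟩ := hg v ⟨u, hu, hvu⟩
      have hFadj : F.Adj (g v) v := by
        refine ⟨hadj.symm, ?_⟩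
        rw [fromEdgeSet_adj]
        exact ⟨⟨v, hv, Sym2.eq_swap⟩, hadj.ne'⟩
      obtain ⟨i, hi⟩ := Set.mem_iUnion.1 hu
      obtain ⟨j, hj⟩ := Set.mem_iUnion.1 hgv
      obtain rfl : i = j := by
        by_contra hij
        exact (hsep i j hij u hi (g v) hj).not_gt
          (wdist_within_lt_three (hclS hu) hv (hclS hgv) hvu.symm hadj)
      obtain ⟨p, hp⟩ := hdiam i u (hclt i hi) (g v) (hclt i hj)
      refine ⟨(p.mapLe ((le_iSup tr i).trans (le_sup_right.trans le_sup_left))).concat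
        (Or.inr hFadj), ?_⟩
      simpa using hp
    refine ⟨H' ⊔ (⨆ i, tr i) ⊔ F, sup_le (sup_le hH'G (iSup_le htG)) inf_le_left, ?_, ?_⟩
    · have hle : ((H' ⊔ (⨆ i, tr i) ⊔ F).edgeSet.ncard : ℝ)
          ≤ H'.edgeSet.ncard + (⨆ i, tr i).edgeSet.ncard + F.edgeSet.ncard := by
        rw [edgeSet_sup, edgeSet_sup]
        exact_mod_cast (Set.ncard_union_le _ _).trans
          (Nat.add_le_add_right (Set.ncard_union_le _ _) _)
      have hFcard' : (F.edgeSet.ncard : ℝ) ≤ S.ncard := by exact_mod_cast hFcard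
      have hhalf : ((S \ ⋃ i, cl i).ncard : ℝ) ≤ S.ncard / 2 := by linarith
      nlinarith [mul_le_mul_of_nonneg_left hhalf (by linarith : 0 ≤ 4 * ξ)]
    · intro u hu v hv huv
      by_cases huc : u ∈ ⋃ i, cl i
      · exact hcluster u huc v hv huv.symm
      by_cases hvc : v ∈ ⋃ i, cl i
      · obtain ⟨p, hp⟩ := hcluster v hvc u hu huv
        exact ⟨p.reverse, by simpa using hp⟩
      · obtain ⟨p, hp⟩ := hH' u ⟨hu, huc⟩ v ⟨hv, hvc⟩ huv
        exact ⟨p.mapLe (le_sup_left.trans le_sup_left), by simpa using hp⟩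
end

section
/- Let G = (V,E) be a connected weighted graph with edge weights in [1, U], let ε > 0 and α ≥ 1, and for each integer i ≥ 0 let E_i = {e ∈ E : (1+ε)^i ≤ w(e) < (1+ε)^{i+1}}. Suppose that for each i with E_i ≠ ∅, H_i ⊆ E_i is (the edge set of) an α-spanner of the unweighted graph (V, E_i), where stretch is measured in hop distance. Then the subgraph of G with edge set ⋃_i H_i is a ((1+ε)·α)-spanner of the weighted graph G. -/
open SimpleGraph

theorem wdist_self {V : Type*} (G : SimpleGraph V) (w : Sym2 V → NNReal) (u : V) :
    wdist G w u u = 0 :=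
  le_antisymm (iInf_le_of_le Walk.nil (by simp)) zero_le

theorem wdist_le_of_adj {V : Type*} {G : SimpleGraph V} (w : Sym2 V → NNReal) {u v : V}
    (h : G.Adj u v) : wdist G w u v ≤ w s(u, v) :=
  iInf_le_of_le (Walk.cons h Walk.nil) (by simp)

theorem wdist_triangle {V : Type*} (G : SimpleGraph V) (w : Sym2 V → NNReal) (a b c : V) :
    wdist G w a c ≤ wdist G w a b + wdist G w b c := by
  refine ENNReal.le_iInf_add_iInf fun p q => iInf_le_of_le (p.append q) ?_
  simp [Walk.edges_append]

/-- A bound on the distance between the endpoints of every edge of `G` extends to a bound on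
all distances. -/
theorem wdist_le_mul_wdist_of_adj {V : Type*} {G H : SimpleGraph V} {w w' : Sym2 V → NNReal}
    {c : ENNReal} (hc : c ≠ 0) (hc' : c ≠ ⊤)
    (h : ∀ u v, G.Adj u v → wdist H w' u v ≤ c * w s(u, v)) (u v : V) :
    wdist H w' u v ≤ c * wdist G w u v := by
  rw [wdist.eq_def G, ENNReal.mul_iInf_of_ne hc hc']
  refine le_iInf fun p => ?_
  induction p with
  | nil => simp [wdist_self]
  | @cons a b d hab p ih =>
    calc wdist H w' a d ≤ wdist H w' a b + wdist H w' b d := wdist_triangle ..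
      _ ≤ c * w s(a, b) + c * ((p.edges.map w).sum : NNReal) := add_le_add (h a b hab) ih
      _ = _ := by simp [mul_add]

/-- the folklore reduction from weighted to unweighted spanners. If the
edges of a connected weighted graph `G` (weights in `[1, U]`) are grouped into the weight
classes `E_i = {e : (1+ε)^i ≤ w e < (1+ε)^(i+1)}` and `H_i` is an `α`-spanner (in hop
distance) of `(V, E_i)`, then `⋃ i, H_i` is a `((1+ε)·α)`-spanner of the weighted `G`. -/
theorem weighted_spanner_of_weight_classes {n : ℕ} (G : SimpleGraph (Fin n))
    (w : Sym2 (Fin n) → NNReal) (U : NNReal)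
    (hw : ∀ e ∈ G.edgeSet, 1 ≤ w e ∧ w e ≤ U) (hG : G.Connected)
    (ε : ℝ) (hε : 0 < ε) (α : ℝ) (hα : 1 ≤ α)
    (Hs : ℕ → Set (Sym2 (Fin n)))
    (hHsub : ∀ i : ℕ, Hs i ⊆
      {e ∈ G.edgeSet | (1 + ε) ^ i ≤ (w e : ℝ) ∧ (w e : ℝ) < (1 + ε) ^ (i + 1)})
    (hspan : ∀ i : ℕ,
      IsSpanner
        (SimpleGraph.fromEdgeSet
          {e ∈ G.edgeSet | (1 + ε) ^ i ≤ (w e : ℝ) ∧ (w e : ℝ) < (1 + ε) ^ (i + 1)})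
        (SimpleGraph.fromEdgeSet (Hs i)) (fun _ => 1) α) :
    IsSpanner G (SimpleGraph.fromEdgeSet (⋃ i, Hs i)) w ((1 + ε) * α) := by
  have hα0 : 0 < α := by linarith
  have hε1 : 0 < 1 + ε := by linarith
  refine ⟨fun u v huv => ?_, wdist_le_mul_wdist_of_adj
    (by simpa using mul_pos hε1 hα0) ENNReal.ofReal_ne_top fun u v huv => ?_⟩
  · rw [fromEdgeSet_adj, Set.mem_iUnion] at huv
    obtain ⟨⟨i, hi⟩, -⟩ := huv
    exact (hHsub i hi).1
  · obtain ⟨i, hi, hi'⟩ := exists_nat_pow_near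
      (show (1 : ℝ) ≤ w s(u, v) by exact_mod_cast (hw s(u, v) huv).1)
      (show 1 < 1 + ε by linarith)
    have hclass : wdist (fromEdgeSet (⋃ i, Hs i)) w u v ≤
        ENNReal.ofReal ((1 + ε) ^ (i + 1)) * wdist (fromEdgeSet (Hs i)) (fun _ => 1) u v := by
      refine wdist_le_mul_wdist_of_adj (by simpa using pow_pos hε1 (i + 1))
        ENNReal.ofReal_ne_top (fun a b hab => ?_) u v
      rw [fromEdgeSet_adj] at hab
      refine (wdist_le_of_adj w
        ((fromEdgeSet_adj _).2 ⟨Set.mem_iUnion.2 ⟨i, hab.1⟩, hab.2⟩)).trans ?_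
      rw [ENNReal.coe_one, mul_one, ← ENNReal.ofReal_coe_nnreal]
      exact ENNReal.ofReal_le_ofReal (hHsub i hab.1).2.2.le
    have hhop : wdist (fromEdgeSet (Hs i)) (fun _ => 1) u v ≤ ENNReal.ofReal α := by
      refine ((hspan i).2 u v).trans ?_
      have hadj : (fromEdgeSet {e ∈ G.edgeSet | (1 + ε) ^ i ≤ (w e : ℝ) ∧
          (w e : ℝ) < (1 + ε) ^ (i + 1)}).Adj u v :=
        (fromEdgeSet_adj _).2 ⟨⟨huv, hi, hi'⟩, huv.ne⟩
      refine (mul_le_mul_right (wdist_le_of_adj _ hadj) _).trans ?_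
      simp
    refine hclass.trans ((mul_le_mul_right hhop _).trans ?_)
    rw [← ENNReal.ofReal_coe_nnreal, ← ENNReal.ofReal_mul (by positivity),
      ← ENNReal.ofReal_mul (by positivity)]
    refine ENNReal.ofReal_le_ofReal ?_
    calc (1 + ε) ^ (i + 1) * α = (1 + ε) * α * (1 + ε) ^ i := by ring
      _ ≤ (1 + ε) * α * w s(u, v) := by gcongr
end
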